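/- arXiv:1201.5717 — 8 statements merged into one kernel-verified Lean document; each statement's English description precedes it below -/
import Mathlib

section
/- Let N ≥ 1 be an integer and let f(z₁,z₂) be a polynomial with complex coefficients in two variables. Fix radii 0 < ε₁ < ε₂. Then the iterated counterclockwise circle integral (1/(2πi))² ∮_{|z₂|=ε₂} ∮_{|z₁|=ε₁} (z₂ − z₁)·f(z₁,z₂) / (z₁^N·(z₂^N − z₁^N)) dz₁ dz₂ is equal to (1/(2πi))² ∮_{|z₂|=ε₂} ∮_{|z₁|=ε₁} (z₂ − z₁)·f(z₁,z₂) / (z₁^N·z₂^N) dz₁ dz₂. (Note that z₂^N − z₁^N ≠ 0 on the contours since |z₁| = ε₁ < ε₂ = |z₂|.) -/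
open MvPolynomial

theorem stmt_0 (N : ℕ) (hN : 1 ≤ N) (f : MvPolynomial (Fin 2) ℂ)
    (ε₁ ε₂ : ℝ) (hε₁ : 0 < ε₁) (hε : ε₁ < ε₂) :
    (1 / (2 * (Real.pi : ℂ) * Complex.I)) ^ 2 *
      (∮ z₂ in C(0, ε₂), ∮ z₁ in C(0, ε₁),
        (z₂ - z₁) * eval ![z₁, z₂] f / (z₁ ^ N * (z₂ ^ N - z₁ ^ N))) =
    (1 / (2 * (Real.pi : ℂ) * Complex.I)) ^ 2 *
      (∮ z₂ in C(0, ε₂), ∮ z₁ in C(0, ε₁),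
        (z₂ - z₁) * eval ![z₁, z₂] f / (z₁ ^ N * z₂ ^ N)) := by
  congr 1
  apply circleIntegral.integral_congr (hε₁.trans hε).le
  intro w hw
  have hw' : ‖w‖ = ε₂ := by simpa using hw
  have hw0 : w ≠ 0 := by
    rintro rfl
    simp at hw'
    linarith
  have hne : ∀ z : ℂ, ‖z‖ ≤ ε₁ → w ^ N - z ^ N ≠ 0 := by
    intro z hz h
    have h1 : ‖w‖ ^ N = ‖z‖ ^ N := by
      rw [← norm_pow, ← norm_pow, sub_eq_zero.mp h]
    have h2 : ‖z‖ ^ N < ‖w‖ ^ N :=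
      pow_lt_pow_left₀ (by linarith) (norm_nonneg _) (by omega)
    linarith
  have hp : Differentiable ℂ (fun z : ℂ => eval ![z, w] f) := by
    induction f using MvPolynomial.induction_on with
    | C a => simp
    | add p q hp hq =>
      simp only [map_add]
      exact hp.add hq
    | mul_X p i hp =>
      simp only [map_mul, eval_X]
      apply hp.mul
      fin_cases i
      · simp
      · simp
  have hA : ContinuousOn (fun z : ℂ => (w - z) * eval ![z, w] f / (z ^ N * (w ^ N - z ^ N)))
      (Metric.sphere 0 ε₁) := by
    apply ContinuousOn.div
    · exact ((continuous_const.sub continuous_id).mul hp.continuous).continuousOn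
    · fun_prop
    · intro z hz
      have hz' : ‖z‖ = ε₁ := by simpa using hz
      have hz0 : z ≠ 0 := by
        rw [← norm_pos_iff]
        linarith
      exact mul_ne_zero (pow_ne_zero _ hz0) (hne z hz'.le)
  have hB : ContinuousOn (fun z : ℂ => (w - z) * eval ![z, w] f / (z ^ N * w ^ N))
      (Metric.sphere 0 ε₁) := by
    apply ContinuousOn.div
    · exact ((continuous_const.sub continuous_id).mul hp.continuous).continuousOn
    · fun_prop
    · intro z hz
      have hz' : ‖z‖ = ε₁ := by simpa using hz
      have hz0 : z ≠ 0 := by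
        rw [← norm_pos_iff]
        linarith
      exact mul_ne_zero (pow_ne_zero _ hz0) (pow_ne_zero _ hw0)
  have hD : DifferentiableOn ℂ
      (fun z : ℂ => (w - z) * eval ![z, w] f / (w ^ N * (w ^ N - z ^ N)))
      (Metric.closedBall 0 ε₁) := by
    apply DifferentiableOn.div
    · exact (((differentiable_const w).sub differentiable_id).mul hp).differentiableOn
    · fun_prop
    · intro z hz
      exact mul_ne_zero (pow_ne_zero _ hw0) (hne z (by simpa using hz))
  have hzero : (∮ z in C(0, ε₁), (w - z) * eval ![z, w] f / (w ^ N * (w ^ N - z ^ N))) = 0 :=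
    Complex.circleIntegral_eq_zero_of_differentiable_on_off_countable hε₁.le
      Set.countable_empty hD.continuousOn
      (fun z hz => (hD z (Metric.ball_subset_closedBall hz.1)).differentiableAt
        (Metric.closedBall_mem_nhds_of_mem hz.1))
  show (∮ z in C(0, ε₁), (w - z) * eval ![z, w] f / (z ^ N * (w ^ N - z ^ N))) =
    ∮ z in C(0, ε₁), (w - z) * eval ![z, w] f / (z ^ N * w ^ N)
  rw [← sub_eq_zero, ← circleIntegral.integral_sub (hA.circleIntegrable hε₁.le)
    (hB.circleIntegrable hε₁.le)]
  refine Eq.trans ?_ hzero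
  apply circleIntegral.integral_congr hε₁.le
  intro z hz
  have hz' : ‖z‖ = ε₁ := by simpa using hz
  have hz0 : z ≠ 0 := by
    rw [← norm_pos_iff]
    linarith
  have h1 := hne z hz'.le
  have h2 := pow_ne_zero N hz0
  have h3 := pow_ne_zero N hw0
  generalize eval ![z, w] f = F
  simp only
  rw [div_sub_div _ _ (mul_ne_zero h2 h1) (mul_ne_zero h2 h3),
    div_eq_div_iff (mul_ne_zero (mul_ne_zero h2 h1) (mul_ne_zero h2 h3)) (mul_ne_zero h3 h1)]
  ring
end

section
/- Let N ≥ 2 be an integer and fix radii 0 < ε₁ < ε₂. Then (1/(2πi))² ∮_{|z₂|=ε₂} ∮_{|z₁|=ε₁} (z₂ − z₁)·z₁^{N−1}·z₂^{N−2} / (z₁^N·(z₂^N − z₁^N)) dz₁ dz₂ = 1, where both contours are counterclockwise circles centered at 0. -/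
theorem stmt_2 (N : ℕ) (hN : 2 ≤ N)
    (ε₁ ε₂ : ℝ) (hε₁ : 0 < ε₁) (hε : ε₁ < ε₂) :
    (1 / (2 * (Real.pi : ℂ) * Complex.I)) ^ 2 *
      (∮ z₂ in C(0, ε₂), ∮ z₁ in C(0, ε₁),
        (z₂ - z₁) * z₁ ^ (N - 1) * z₂ ^ (N - 2) / (z₁ ^ N * (z₂ ^ N - z₁ ^ N))) = 1 := by
  obtain ⟨m, rfl⟩ : ∃ m, N = m + 2 := ⟨N - 2, by omega⟩
  have hε₂ : 0 < ε₂ := hε₁.trans hε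
  have key : Set.EqOn (fun z₂ : ℂ => ∮ z₁ in C(0, ε₁),
        (z₂ - z₁) * z₁ ^ (m + 2 - 1) * z₂ ^ (m + 2 - 2) /
          (z₁ ^ (m + 2) * (z₂ ^ (m + 2) - z₁ ^ (m + 2))))
      (fun z₂ => (2 * (Real.pi : ℂ) * Complex.I) * (z₂ - 0)⁻¹) (Metric.sphere 0 ε₂) := by
    intro z₂ hz₂
    have hn2 : ‖z₂‖ = ε₂ := by simpa using hz₂
    have hz0 : z₂ ≠ 0 := by
      rw [← norm_pos_iff, hn2]; exact hε₂
    have hne : ∀ z₁ ∈ Metric.closedBall (0 : ℂ) ε₁, z₂ ^ (m + 2) - z₁ ^ (m + 2) ≠ 0 := by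
      intro z₁ hz₁ h
      have hn1 : ‖z₁‖ ≤ ε₁ := by simpa using hz₁
      have h2 : ‖z₂‖ ^ (m + 2) = ‖z₁‖ ^ (m + 2) := by
        rw [← norm_pow, ← norm_pow, sub_eq_zero.mp h]
      have h3 : ‖z₁‖ ^ (m + 2) < ‖z₂‖ ^ (m + 2) :=
        pow_lt_pow_left₀ (by linarith) (norm_nonneg _) (by omega)
      linarith
    have hd : DifferentiableOn ℂ
        (fun z₁ : ℂ => (z₂ - z₁) * z₂ ^ m / (z₂ ^ (m + 2) - z₁ ^ (m + 2)))
        (Metric.closedBall 0 ε₁) :=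
      DifferentiableOn.div (by fun_prop) (by fun_prop) hne
    have hc := DifferentiableOn.circleIntegral_sub_inv_smul hd
      (Metric.mem_ball_self hε₁)
    have hcongr : (∮ z₁ in C(0, ε₁),
        (z₂ - z₁) * z₁ ^ (m + 2 - 1) * z₂ ^ (m + 2 - 2) /
          (z₁ ^ (m + 2) * (z₂ ^ (m + 2) - z₁ ^ (m + 2)))) =
        ∮ z₁ in C(0, ε₁), (z₁ - 0)⁻¹ •
          ((z₂ - z₁) * z₂ ^ m / (z₂ ^ (m + 2) - z₁ ^ (m + 2))) := by
      refine circleIntegral.integral_congr hε₁.le ?_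
      intro z₁ hz₁
      have h0 : z₁ ≠ 0 := by
        have hn1 : ‖z₁‖ = ε₁ := by simpa using hz₁
        rw [← norm_pos_iff, hn1]; exact hε₁
      have h1 := hne z₁ (Metric.sphere_subset_closedBall hz₁)
      have e1 : m + 2 - 1 = m + 1 := by omega
      have e2 : m + 2 - 2 = m := by omega
      simp only [e1, e2, sub_zero, smul_eq_mul]
      rw [inv_mul_eq_div, div_div, div_eq_div_iff (by positivity) (by positivity)]
      ring
    show (∮ z₁ in C(0, ε₁), _) = _
    rw [hcongr, hc]
    simp only [smul_eq_mul, sub_zero]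
    congr 1
    rw [zero_pow (by omega), sub_zero]
    field_simp
    ring
  rw [circleIntegral.integral_congr hε₂.le key, circleIntegral.integral_const_mul,
    circleIntegral.integral_sub_center_inv _ hε₂.ne']
  have := Complex.two_pi_I_ne_zero
  field_simp
end

section
/- Let N ≥ 1 be an integer, let f(z₁,z₂) be a homogeneous polynomial of degree d with complex coefficients, and suppose d ≠ 2N − 3. Fix radii 0 < ε₁ < ε₂. Then (1/(2πi))² ∮_{|z₂|=ε₂} ∮_{|z₁|=ε₁} (z₂ − z₁)·f(z₁,z₂) / (z₁^N·(z₂^N − z₁^N)) dz₁ dz₂ = 0. -/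
open MvPolynomial

lemma circ_rot (g : ℂ → ℂ) (R α : ℝ) :
    (∮ z in C(0, R), g z) = ∮ z in C(0, R),
      Complex.exp (α * Complex.I) * g (Complex.exp (α * Complex.I) * z) := by
  have hc : ∀ θ : ℝ, Complex.exp (α * Complex.I) * circleMap 0 R θ = circleMap 0 R (θ + α) := by
    intro θ
    simp only [circleMap, zero_add]
    push_cast
    rw [add_mul, Complex.exp_add]; ring
  let F : ℝ → ℂ := fun θ => deriv (circleMap 0 R) θ • g (circleMap 0 R θ)
  have hF : Function.Periodic F (2 * Real.pi) := by
    intro θ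
    simp only [F, deriv_circleMap, periodic_circleMap 0 R θ]
  have h1 : (∫ θ in (0:ℝ)..2 * Real.pi, F (θ + α)) = ∫ θ in (0:ℝ)..2 * Real.pi, F θ := by
    rw [intervalIntegral.integral_comp_add_right]
    have := hF.intervalIntegral_add_eq α 0
    simpa [add_comm] using this
  unfold circleIntegral
  change (∫ θ in (0:ℝ)..2 * Real.pi, F θ) = _
  rw [← h1]
  congr 1
  funext θ
  simp only [F, deriv_circleMap, hc, smul_eq_mul]
  rw [← hc]; ring

lemma eval_hom (d : ℕ) (f : MvPolynomial (Fin 2) ℂ) (hf : f.IsHomogeneous d) (u a b : ℂ) :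
    eval ![u * a, u * b] f = u ^ d * eval ![a, b] f := by
  rw [eval_eq', eval_eq', Finset.mul_sum]
  refine Finset.sum_congr rfl fun m hm => ?_
  have h := hf (mem_support_iff.1 hm)
  rw [Finsupp.weight_apply, Finsupp.sum_fintype _ _ (by simp)] at h
  simp [Fin.sum_univ_two] at h
  simp [Fin.prod_univ_two, ← h, pow_add, mul_pow]
  ring

theorem stmt_5 (N : ℕ) (hN : 1 ≤ N) (d : ℕ) (f : MvPolynomial (Fin 2) ℂ)
    (hf : f.IsHomogeneous d) (hd : (d : ℤ) ≠ 2 * (N : ℤ) - 3)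
    (ε₁ ε₂ : ℝ) (hε₁ : 0 < ε₁) (hε : ε₁ < ε₂) :
    (1 / (2 * (Real.pi : ℂ) * Complex.I)) ^ 2 *
      (∮ z₂ in C(0, ε₂), ∮ z₁ in C(0, ε₁),
        (z₂ - z₁) * eval ![z₁, z₂] f / (z₁ ^ N * (z₂ ^ N - z₁ ^ N))) = 0 := by
  have hε₂ : 0 < ε₂ := hε₁.trans hε
  have hε₂c : (ε₂ : ℂ) ≠ 0 := by exact_mod_cast hε₂.ne'
  let G : ℂ → ℂ := fun z₂ => ∮ z₁ in C(0, ε₁),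
        (z₂ - z₁) * eval ![z₁, z₂] f / (z₁ ^ N * (z₂ ^ N - z₁ ^ N))
  have key : ∀ z ∈ Metric.sphere (0:ℂ) ε₂,
      G z = ((ε₂ : ℂ) ^ ((d : ℤ) + 2 - 2 * N))⁻¹ * G ε₂ * (z - 0) ^ ((d : ℤ) + 2 - 2 * N) := by
    intro z hz
    have hz' : ‖z‖ = ε₂ := by simpa using hz
    set u := Complex.exp (z.arg * Complex.I) with hu
    have hu0 : u ≠ 0 := Complex.exp_ne_zero _
    have hzu : z = u * ε₂ := by
      rw [← hz', mul_comm]; exact (Complex.norm_mul_exp_arg_mul_I z).symm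
    have h1 : G z = u ^ ((d : ℤ) + 2 - 2 * N) * G ε₂ := by
      simp only [G]
      rw [circ_rot _ ε₁ z.arg, ← circleIntegral.integral_const_mul, ← hu, hzu]
      congr 1
      funext w
      rw [eval_hom d f hf, mul_pow, mul_pow, ← mul_sub, ← mul_sub, zpow_sub₀ hu0, zpow_add₀ hu0,
        two_mul, zpow_add₀ hu0]
      simp only [zpow_natCast]
      have e : u ^ N * w ^ N * (u ^ N * ((ε₂:ℂ) ^ N - w ^ N)) =
        (u ^ N * u ^ N) * (w ^ N * ((ε₂:ℂ) ^ N - w ^ N)) := by ring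
      rw [e, div_eq_mul_inv, div_eq_mul_inv, div_eq_mul_inv, mul_inv (u ^ N * u ^ N)]
      have : u ^ (2 : ℤ) = u ^ 2 := by norm_cast
      rw [this]
      ring
    rw [h1, sub_zero, hzu, mul_zpow]
    have := zpow_ne_zero ((d : ℤ) + 2 - 2 * N) hε₂c
    field_simp
  have : (∮ z₂ in C(0, ε₂), G z₂) = 0 := by
    rw [circleIntegral.integral_congr hε₂.le key, circleIntegral.integral_const_mul,
      circleIntegral.integral_sub_zpow_of_ne (by omega), mul_zero]
  change _ * (∮ z₂ in C(0, ε₂), G z₂) = 0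
  rw [this, mul_zero]
end

section
/- Let N ≥ 1 be an integer, f(z₁,z₂) a polynomial with complex coefficients, and fix radii 0 < ε₁ < ε₂. Then (1/(2πi))² ∮_{|z₂|=ε₂} ∮_{|z₁|=ε₁} (z₂ − z₁)·f(z₁,z₂) / (z₁^N·(z₂^N − z₁^N)) dz₁ dz₂ equals the coefficient of the monomial z₁^{N−1}·z₂^{N−1} in the polynomial (z₂ − z₁)·f(z₁,z₂). -/
open MvPolynomial

lemma zpow_int (R : ℝ) (hR : 0 < R) (n : ℤ) :
    (∮ z in C(0, R), z ^ n) = if n = -1 then 2 * (Real.pi : ℂ) * Complex.I else 0 := by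
  split_ifs with h
  · subst h
    have := circleIntegral.integral_sub_center_inv 0 hR.ne'
    simpa using this
  · have := circleIntegral.integral_sub_zpow_of_ne h 0 0 R
    simpa using this

lemma zpow_ci (R : ℝ) (hR : 0 < R) (n : ℤ) : CircleIntegrable (fun z : ℂ => z ^ n) 0 R := by
  apply ContinuousOn.circleIntegrable hR.le
  intro z hz
  have : z ≠ 0 := by
    rintro rfl
    simp at hz
    exact hR.ne hz
  exact (continuousAt_zpow₀ z n (Or.inl this)).continuousWithinAt

lemma den_ne (N : ℕ) (hN : 1 ≤ N) (z w : ℂ) (h : ‖z‖ < ‖w‖) : w ^ N - z ^ N ≠ 0 := by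
  intro h0
  have h1 := congrArg norm (sub_eq_zero.1 h0)
  rw [norm_pow, norm_pow] at h1
  exact (pow_lt_pow_left₀ h (norm_nonneg _) (by omega)).ne' h1

lemma hol_diff (N : ℕ) (hN : 1 ≤ N) (a : ℕ) (R : ℝ) (w : ℂ) (h : R < ‖w‖) :
    DifferentiableOn ℂ (fun z : ℂ => z ^ a / (w ^ N - z ^ N)) (Metric.closedBall 0 R) := by
  intro z hz
  have hz' : ‖z‖ ≤ R := by simpa using hz
  have := den_ne N hN z w (hz'.trans_lt h)
  apply DifferentiableAt.differentiableWithinAt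
  fun_prop (disch := assumption)

lemma hol_int (N : ℕ) (hN : 1 ≤ N) (a : ℕ) (R : ℝ) (hR : 0 < R) (w : ℂ) (h : R < ‖w‖) :
    (∮ z in C(0, R), z ^ a / (w ^ N - z ^ N)) = 0 := by
  have hd := hol_diff N hN a R w h
  apply Complex.circleIntegral_eq_zero_of_differentiable_on_off_countable hR.le
    Set.countable_empty hd.continuousOn
  intro z hz
  exact hd.differentiableAt (Metric.closedBall_mem_nhds_of_mem (by simpa using hz))

lemma inner_mono (N : ℕ) (hN : 1 ≤ N) (a : ℕ) (R : ℝ) (hR : 0 < R) (w : ℂ) (h : R < ‖w‖) :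
    CircleIntegrable (fun z : ℂ => z ^ a / (z ^ N * (w ^ N - z ^ N))) 0 R ∧
    (∮ z in C(0, R), z ^ a / (z ^ N * (w ^ N - z ^ N))) =
      if a = N - 1 then 2 * (Real.pi : ℂ) * Complex.I * (w ^ N)⁻¹ else 0 := by
  have hw : w ≠ 0 := by
    rintro rfl
    simp at h
    linarith
  have hE : Set.EqOn (fun z : ℂ => z ^ a / (z ^ N * (w ^ N - z ^ N)))
      (fun z => (w ^ N)⁻¹ * (z ^ ((a : ℤ) - N) + z ^ a / (w ^ N - z ^ N)))
      (Metric.sphere 0 R) := by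
    intro z hz
    have hz' : ‖z‖ = R := by simpa using hz
    have hz0 : z ≠ 0 := by
      rintro rfl
      simp at hz'
      linarith
    have := den_ne N hN z w (hz'.trans_lt h)
    simp only [zpow_sub₀ hz0, zpow_natCast]
    field_simp
    ring
  have h1 := zpow_ci R hR ((a : ℤ) - N)
  have h2 : CircleIntegrable (fun z : ℂ => z ^ a / (w ^ N - z ^ N)) 0 R :=
    ((hol_diff N hN a R w h).continuousOn.mono Metric.sphere_subset_closedBall).circleIntegrable
      hR.le
  have h3 : CircleIntegrable
      (fun z : ℂ => (w ^ N)⁻¹ * (z ^ ((a : ℤ) - N) + z ^ a / (w ^ N - z ^ N))) 0 R :=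
    (h1.add h2).const_smul (a := (w ^ N)⁻¹)
  constructor
  · refine (circleIntegrable_congr ?_).2 h3
    rwa [abs_of_pos hR]
  · rw [circleIntegral.integral_congr hR.le hE, circleIntegral.integral_const_mul,
      circleIntegral.integral_add h1 h2, hol_int N hN a R hR w h, zpow_int R hR]
    have : ((a : ℤ) - N = -1) ↔ a = N - 1 := by omega
    simp only [this]
    split_ifs <;> ring

theorem gen (N : ℕ) (hN : 1 ≤ N) (g : MvPolynomial (Fin 2) ℂ)
    (ε₁ ε₂ : ℝ) (hε₁ : 0 < ε₁) (hε : ε₁ < ε₂) :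
      (∮ z₂ in C(0, ε₂), ∮ z₁ in C(0, ε₁),
        eval ![z₁, z₂] g / (z₁ ^ N * (z₂ ^ N - z₁ ^ N))) =
    (2 * (Real.pi : ℂ) * Complex.I) ^ 2 *
     g.coeff (Finsupp.single 0 (N - 1) + Finsupp.single 1 (N - 1)) := by
  have h2 : 0 < ε₂ := hε₁.trans hε
  have hE : Set.EqOn (fun z₂ : ℂ => ∮ z₁ in C(0, ε₁),
        eval ![z₁, z₂] g / (z₁ ^ N * (z₂ ^ N - z₁ ^ N)))
      (fun w => ∑ d ∈ g.support, (g.coeff d * (if d 0 = N - 1 then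
        2 * (Real.pi : ℂ) * Complex.I else 0)) * w ^ ((d 1 : ℤ) - N)) (Metric.sphere 0 ε₂) := by
    intro w hw
    have hw' : ‖w‖ = ε₂ := by simpa using hw
    have hw0 : w ≠ 0 := by
      rintro rfl
      simp at hw'
      linarith
    have hlt : ε₁ < ‖w‖ := by rw [hw']; exact hε
    have : ∀ z : ℂ, eval ![z, w] g / (z ^ N * (w ^ N - z ^ N)) =
        ∑ d ∈ g.support, (g.coeff d * w ^ (d 1)) * (z ^ (d 0) / (z ^ N * (w ^ N - z ^ N))) := by
      intro z
      rw [eval_eq', Finset.sum_div]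
      refine Finset.sum_congr rfl fun d _ => ?_
      simp [Fin.prod_univ_two]
      ring
    simp only [this]
    rw [circleIntegral.integral_fun_sum]
    · refine Finset.sum_congr rfl fun d _ => ?_
      rw [circleIntegral.integral_const_mul, (inner_mono N hN (d 0) ε₁ hε₁ w hlt).2,
        zpow_sub₀ hw0, zpow_natCast, zpow_natCast]
      split_ifs
      · ring
      · ring
    · intro d _
      exact (inner_mono N hN (d 0) ε₁ hε₁ w hlt).1.const_smul (a := g.coeff d * w ^ (d 1))
  rw [circleIntegral.integral_congr h2.le hE, circleIntegral.integral_fun_sum]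
  · simp only [circleIntegral.integral_const_mul, zpow_int ε₂ h2]
    rw [Finset.sum_eq_single (Finsupp.single 0 (N - 1) + Finsupp.single 1 (N - 1))]
    · have : ((N - 1 : ℕ) : ℤ) - N = -1 := by omega
      simp [this]
      ring
    · intro d _ hd
      by_cases h0 : d 0 = N - 1
      · have h1 : ¬ ((d 1 : ℤ) - N = -1) := by
          intro h1
          apply hd
          ext i
          fin_cases i
          · simp [h0]
          · simp
            omega
        simp [h1]
      · simp [h0]
    · intro h
      rw [notMem_support_iff.1 h]
      simp
  · intro d _
    exact (zpow_ci ε₂ h2 _).const_smul (a := (g.coeff d * (if d 0 = N - 1 then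
        2 * (Real.pi : ℂ) * Complex.I else 0)))

theorem stmt_7 (N : ℕ) (hN : 1 ≤ N) (f : MvPolynomial (Fin 2) ℂ)
    (ε₁ ε₂ : ℝ) (hε₁ : 0 < ε₁) (hε : ε₁ < ε₂) :
    (1 / (2 * (Real.pi : ℂ) * Complex.I)) ^ 2 *
      (∮ z₂ in C(0, ε₂), ∮ z₁ in C(0, ε₁),
        (z₂ - z₁) * eval ![z₁, z₂] f / (z₁ ^ N * (z₂ ^ N - z₁ ^ N))) =
    ((X 1 - X 0) * f).coeff (Finsupp.single 0 (N - 1) + Finsupp.single 1 (N - 1)) := by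
  have h := gen N hN ((X 1 - X 0) * f) ε₁ ε₂ hε₁ hε
  have e : ∀ z w : ℂ, eval ![z, w] ((X 1 - X 0) * f) = (w - z) * eval ![z, w] f := by
    intro z w
    simp
  simp only [e] at h
  rw [h, ← mul_assoc, ← mul_pow, one_div, inv_mul_cancel₀ Complex.two_pi_I_ne_zero]
  simp
end

section
/- Let N ≥ 2 be an integer, fix radii 0 < ε₁ < ε₂, and let p, q be nonnegative integers with p + q = 2N − 3. Define I(p,q) := (1/(2πi))² ∮_{|z₂|=ε₂} ∮_{|z₁|=ε₁} (z₂ − z₁)·z₁^p·z₂^q / (z₁^N·(z₂^N − z₁^N)) dz₁ dz₂. Then I(N−1, N−2) = 1, I(N−2, N−1) = −1, and I(p,q) = 0 for all other pairs (p,q) with p + q = 2N − 3. -/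
theorem aux_ne (N : ℕ) (hN : 2 ≤ N) (ε : ℝ) (w z : ℂ) (hw : ε < ‖w‖) (hz : ‖z‖ ≤ ε) :
    w ^ N - z ^ N ≠ 0 := by
  intro h
  have h1 : ‖w‖ ^ N = ‖z‖ ^ N := by
    rw [← norm_pow, ← norm_pow, sub_eq_zero.mp h]
  have h2 : ‖z‖ ^ N < ‖w‖ ^ N :=
    pow_lt_pow_left₀ (lt_of_le_of_lt hz hw) (norm_nonneg _) (by omega)
  linarith

theorem aux_cont (N : ℕ) (hN : 2 ≤ N) (ε : ℝ) (hε : 0 < ε) (w : ℂ) (hw : ε < ‖w‖) (m : ℕ) :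
    CircleIntegrable (fun z : ℂ => z ^ m / (z ^ N * (w ^ N - z ^ N))) 0 ε := by
  apply ContinuousOn.circleIntegrable hε.le
  apply ContinuousOn.div (by fun_prop) (by fun_prop)
  intro z hz
  have hz' : ‖z‖ = ε := by simpa using hz
  refine mul_ne_zero (pow_ne_zero _ ?_) (aux_ne N hN ε w z hw hz'.le)
  rw [← norm_pos_iff, hz']; exact hε

theorem aux_J (N : ℕ) (hN : 2 ≤ N) (ε : ℝ) (hε : 0 < ε) (w : ℂ) (hw : ε < ‖w‖) (m : ℕ) :
    (∮ z in C(0, ε), z ^ m / (z ^ N * (w ^ N - z ^ N))) =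
      if m = N - 1 then 2 * (Real.pi : ℂ) * Complex.I / w ^ N else 0 := by
  have hw0 : w ≠ 0 := by
    rw [← norm_pos_iff]; linarith
  have hwN : w ^ N ≠ 0 := pow_ne_zero _ hw0
  have h1 : (∮ z in C(0, ε), z ^ m / (z ^ N * (w ^ N - z ^ N))) =
      ∮ z in C(0, ε), ((w ^ N)⁻¹ * (z - 0) ^ ((m : ℤ) - N) + (w ^ N)⁻¹ * (z ^ m / (w ^ N - z ^ N))) := by
    apply circleIntegral.integral_congr hε.le
    intro z hz
    have hz' : ‖z‖ = ε := by simpa using hz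
    have hz0 : z ≠ 0 := by
      rw [← norm_pos_iff, hz']; exact hε
    have hne := aux_ne N hN ε w z hw hz'.le
    have hzN : z ^ N ≠ 0 := pow_ne_zero _ hz0
    simp only [sub_zero]
    rw [zpow_sub₀ hz0, zpow_natCast, zpow_natCast]
    field_simp
    ring
  have hc2 : ContinuousOn (fun z : ℂ => z ^ m / (w ^ N - z ^ N)) (Metric.closedBall 0 ε) := by
    apply ContinuousOn.div (by fun_prop) (by fun_prop)
    intro z hz
    exact aux_ne N hN ε w z hw (by simpa using hz)
  have h0 : (∮ z in C(0, ε), z ^ m / (w ^ N - z ^ N)) = 0 := by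
    apply Complex.circleIntegral_eq_zero_of_differentiable_on_off_countable hε.le
      Set.countable_empty hc2
    intro z hz
    have hz2 : ‖z‖ < ε := by simpa using hz.1
    exact DifferentiableAt.div (by fun_prop) (by fun_prop) (aux_ne N hN ε w z hw hz2.le)
  rw [h1, circleIntegral.integral_add, circleIntegral.integral_const_mul,
    circleIntegral.integral_const_mul, h0, mul_zero, add_zero]
  · split_ifs with h
    · have : (m : ℤ) - N = -1 := by omega
      rw [this]
      simp only [zpow_neg_one]
      rw [circleIntegral.integral_sub_center_inv 0 hε.ne']
      field_simp
    · rw [circleIntegral.integral_sub_zpow_of_ne (by omega), mul_zero]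
  · apply ContinuousOn.circleIntegrable hε.le
    intro z hz
    have hz' : ‖z‖ = ε := by simpa using hz
    have hz0 : z - 0 ≠ 0 := by
      rw [sub_zero, ← norm_pos_iff, hz']; exact hε
    apply ContinuousAt.continuousWithinAt
    exact continuousAt_const.mul (ContinuousAt.zpow₀ (by fun_prop) _ (Or.inl hz0))
  · apply ContinuousOn.circleIntegrable hε.le
    exact continuousOn_const.mul (hc2.mono Metric.sphere_subset_closedBall)

theorem aux_inner (N : ℕ) (hN : 2 ≤ N) (ε : ℝ) (hε : 0 < ε) (w : ℂ) (hw : ε < ‖w‖) (p q : ℕ)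
    (hpq : p + q = 2 * N - 3) :
    (∮ z in C(0, ε), (w - z) * z ^ p * w ^ q / (z ^ N * (w ^ N - z ^ N))) =
      (2 * (Real.pi : ℂ) * Complex.I * (if p = N - 1 ∧ q = N - 2 then 1
     else if p = N - 2 ∧ q = N - 1 then -1
     else 0)) * (w - 0)⁻¹ := by
  have hw0 : w ≠ 0 := by
    rw [← norm_pos_iff]; linarith
  have h1 : (∮ z in C(0, ε), (w - z) * z ^ p * w ^ q / (z ^ N * (w ^ N - z ^ N))) =
      ∮ z in C(0, ε), (w ^ (q + 1) * (z ^ p / (z ^ N * (w ^ N - z ^ N))) -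
        w ^ q * (z ^ (p + 1) / (z ^ N * (w ^ N - z ^ N)))) := by
    congr 1
    funext z
    ring
  have hi := fun m => aux_cont N hN ε hε w hw m
  rw [h1, circleIntegral.integral_sub, circleIntegral.integral_const_mul,
    circleIntegral.integral_const_mul, aux_J N hN ε hε w hw, aux_J N hN ε hε w hw]
  · obtain ⟨k, rfl⟩ : ∃ k, N = k + 2 := ⟨N - 2, by omega⟩
    by_cases ha : p = k + 1
    · have hq : q = k := by omega
      subst ha hq
      simp
      field_simp
      ring
    · by_cases hb : p = k
      · have hq : q = k + 1 := by omega
        subst hb hq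
        simp
        field_simp
        ring
      · simp [ha, hb]
  · exact (hi p).const_smul (a := w ^ (q + 1))
  · exact (hi (p + 1)).const_smul (a := w ^ q)

theorem stmt_8 (N : ℕ) (hN : 2 ≤ N)
    (ε₁ ε₂ : ℝ) (hε₁ : 0 < ε₁) (hε : ε₁ < ε₂)
    (p q : ℕ) (hpq : p + q = 2 * N - 3) :
    (1 / (2 * (Real.pi : ℂ) * Complex.I)) ^ 2 *
      (∮ z₂ in C(0, ε₂), ∮ z₁ in C(0, ε₁),
        (z₂ - z₁) * z₁ ^ p * z₂ ^ q / (z₁ ^ N * (z₂ ^ N - z₁ ^ N))) =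
    (if p = N - 1 ∧ q = N - 2 then 1
     else if p = N - 2 ∧ q = N - 1 then -1
     else 0) := by
  have h2 : 0 < ε₂ := hε₁.trans hε
  rw [circleIntegral.integral_congr h2.le (fun w hw => aux_inner N hN ε₁ hε₁ w
    (by have : ‖w‖ = ε₂ := by simpa using hw
        rw [this]; exact hε) p q hpq),
    circleIntegral.integral_const_mul, circleIntegral.integral_sub_center_inv 0 h2.ne']
  have hpi : (Real.pi : ℂ) ≠ 0 := by exact_mod_cast Real.pi_ne_zero
  have hI := Complex.I_ne_zero
  generalize (if p = N - 1 ∧ q = N - 2 then (1 : ℂ)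
     else if p = N - 2 ∧ q = N - 1 then -1
     else 0) = c
  field_simp
end

section
/- Let N ≥ 1 and k ≥ 1 be integers, let a, b be positive integers, let e^k(z₁,z₂) := Π_{j=0}^{k} (j·z₁ + (k−j)·z₂), let w_a(z₁,z₂) := Σ_{j=0}^{a−1} z₁^j·z₂^{a−1−j} (the polynomial equal to (z₁^a − z₂^a)/(z₁ − z₂)), and fix radii ε₁, ε₂ > 0. Then (1/(2πi))² ∮_{|z₂|=ε₂} ∮_{|z₁|=ε₁} (z₂ − z₁)·e^k(z₁,z₂)·z₁^a·w_b(z₁,z₂) / (z₁^N·z₂^N) dz₁ dz₂ = −(1/2)·(1/(2πi))² ∮_{|z₂|=ε₂} ∮_{|z₁|=ε₁} e^k(z₁,z₂)·(z₁ − z₂)²·w_a(z₁,z₂)·w_b(z₁,z₂) / (z₁^N·z₂^N) dz₁ dz₂. -/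
/-- `e^k(z₁,z₂) = ∏_{j=0}^{k} (j z₁ + (k-j) z₂)`. -/
noncomputable def ek (k : ℕ) (z w : ℂ) : ℂ :=
  ∏ j ∈ Finset.range (k + 1), ((j : ℂ) * z + ((k : ℂ) - (j : ℂ)) * w)

/-- `w_a(z₁,z₂) = ∑_{j=0}^{a-1} z₁^j z₂^{a-1-j} = (z₁^a - z₂^a)/(z₁ - z₂)`. -/
noncomputable def wa (a : ℕ) (z w : ℂ) : ℂ :=
  ∑ j ∈ Finset.range a, z ^ j * w ^ (a - 1 - j)

open MvPolynomial in
theorem aux_I (N : ℕ) (p : MvPolynomial (Fin 2) ℂ) (u v : ℂ) (ε₁ ε₂ : ℝ) (h1 : 0 < ε₁) (h2 : 0 < ε₂) :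
    (∮ z₂ in C(0, ε₂), ∮ z₁ in C(0, ε₁),
      (u * eval ![z₁, z₂] p + v * eval ![z₂, z₁] p) / (z₁ ^ N * z₂ ^ N)) =
    (u + v) * ∑ m ∈ p.support, coeff m p *
      ((∮ z in C(0, 1), z ^ (m 0) / z ^ N) * (∮ z in C(0, 1), z ^ (m 1) / z ^ N)) := by
  have hJ : ∀ (m : ℕ) (ε : ℝ), 0 < ε →
      (∮ z in C(0, ε), z ^ m / z ^ N) = ∮ z in C(0, 1), z ^ m / z ^ N := by
    intro m ε hε
    have key : ∀ r : ℝ, 0 < r → (∮ z in C(0, r), z ^ m / z ^ N)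
        = if (m : ℤ) - N = -1 then 2 * Real.pi * Complex.I else 0 := by
      intro r hr
      have e : (∮ z in C(0, r), z ^ m / z ^ N) = ∮ z in C(0, r), (z - 0) ^ ((m : ℤ) - N) := by
        apply circleIntegral.integral_congr hr.le
        intro z hz
        have : z ≠ 0 := by
          rintro rfl
          simp at hz
          exact hr.ne hz
        simp [zpow_sub₀ this]
      rw [e]
      split_ifs with h
      · rw [h]
        simp only [zpow_neg_one]
        exact circleIntegral.integral_sub_center_inv 0 hr.ne'
      · exact circleIntegral.integral_sub_zpow_of_ne h 0 0 r
    rw [key ε hε, key 1 one_pos]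
  have hint : ∀ (m : ℕ) (ε : ℝ), 0 < ε → CircleIntegrable (fun z : ℂ => z ^ m / z ^ N) 0 ε := by
    intro m ε hε
    apply ContinuousOn.circleIntegrable hε.le
    apply ContinuousOn.div (by fun_prop) (by fun_prop)
    intro z hz h0
    have : z = 0 := by
      by_contra h
      exact pow_ne_zero _ h h0
    subst this
    simp at hz
    exact hε.ne hz
  have hexp : ∀ z₁ z₂ : ℂ, (u * eval ![z₁, z₂] p + v * eval ![z₂, z₁] p) / (z₁ ^ N * z₂ ^ N) =
      ∑ m ∈ p.support, ((u * coeff m p * (z₂ ^ (m 1) / z₂ ^ N)) * (z₁ ^ (m 0) / z₁ ^ N) +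
        (v * coeff m p * (z₂ ^ (m 0) / z₂ ^ N)) * (z₁ ^ (m 1) / z₁ ^ N)) := by
    intro z w
    rw [eval_eq', eval_eq', Finset.mul_sum, Finset.mul_sum, ← Finset.sum_add_distrib, Finset.sum_div]
    refine Finset.sum_congr rfl fun m _ => ?_
    simp only [Fin.prod_univ_two, Matrix.cons_val_zero, Matrix.cons_val_one]
    simp only [div_eq_mul_inv, mul_inv]
    ring
  simp only [hexp]
  have hin : ∀ z₂ : ℂ, (∮ z₁ in C(0, ε₁),
      ∑ m ∈ p.support, ((u * coeff m p * (z₂ ^ (m 1) / z₂ ^ N)) * (z₁ ^ (m 0) / z₁ ^ N) +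
        (v * coeff m p * (z₂ ^ (m 0) / z₂ ^ N)) * (z₁ ^ (m 1) / z₁ ^ N))) =
      ∑ m ∈ p.support, ((u * coeff m p * (∮ z in C(0, 1), z ^ (m 0) / z ^ N)) * (z₂ ^ (m 1) / z₂ ^ N) +
        (v * coeff m p * (∮ z in C(0, 1), z ^ (m 1) / z ^ N)) * (z₂ ^ (m 0) / z₂ ^ N)) := by
    intro w
    rw [circleIntegral.integral_fun_sum]
    · refine Finset.sum_congr rfl fun m _ => ?_
      rw [circleIntegral.integral_add, circleIntegral.integral_const_mul,
        circleIntegral.integral_const_mul, hJ _ _ h1, hJ _ _ h1]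
      · ring
      · exact (hint _ _ h1).const_fun_smul
      · exact (hint _ _ h1).const_fun_smul
    · intro m _
      exact ((hint _ _ h1).const_fun_smul).add ((hint _ _ h1).const_fun_smul)
  simp only [hin]
  rw [circleIntegral.integral_fun_sum, Finset.mul_sum]
  · refine Finset.sum_congr rfl fun m _ => ?_
    rw [circleIntegral.integral_add, circleIntegral.integral_const_mul,
      circleIntegral.integral_const_mul, hJ _ _ h2, hJ _ _ h2]
    · ring
    · exact (hint _ _ h2).const_fun_smul
    · exact (hint _ _ h2).const_fun_smul
  · intro m _
    exact ((hint _ _ h2).const_fun_smul).add ((hint _ _ h2).const_fun_smul)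

theorem ek_symm (k : ℕ) (z w : ℂ) : ek k w z = ek k z w := by
  unfold ek
  rw [← Finset.prod_range_reflect]
  refine Finset.prod_congr rfl fun j hj => ?_
  have : j ≤ k := by simp at hj; omega
  have e : k + 1 - 1 - j = k - j := by omega
  rw [e, Nat.cast_sub this]
  ring

theorem wa_symm (k : ℕ) (z w : ℂ) : wa k w z = wa k z w := by
  unfold wa
  rw [← Finset.sum_range_reflect]
  refine Finset.sum_congr rfl fun j hj => ?_
  have : j < k := by simpa using hj
  have e : k - 1 - (k - 1 - j) = j := by omega
  rw [e]
  ring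

theorem wa_mul (a : ℕ) (z w : ℂ) : (z - w) * wa a z w = z ^ a - w ^ a := by
  unfold wa
  exact (Commute.all z w).mul_geom_sum₂ a

open MvPolynomial in
theorem exists_poly (k a b : ℕ) : ∃ p : MvPolynomial (Fin 2) ℂ, ∀ z w : ℂ,
    eval ![z, w] p = (w - z) * ek k z w * z ^ a * wa b z w := by
  refine ⟨(X 1 - X 0) * (∏ j ∈ Finset.range (k + 1), (C (j : ℂ) * X 0 + C ((k : ℂ) - (j : ℂ)) * X 1))
    * X 0 ^ a * ∑ j ∈ Finset.range b, X 0 ^ j * X 1 ^ (b - 1 - j), fun z w => ?_⟩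
  simp only [map_mul, map_sub, map_prod, map_sum, map_add, map_pow, eval_X, eval_C, ek, wa,
    Matrix.cons_val_zero, Matrix.cons_val_one]

theorem stmt_10 (N k : ℕ) (hN : 1 ≤ N) (hk : 1 ≤ k) (a b : ℕ)
    (ha : 1 ≤ a) (hb : 1 ≤ b)
    (ε₁ ε₂ : ℝ) (hε₁ : 0 < ε₁) (hε₂ : 0 < ε₂) :
    (1 / (2 * (Real.pi : ℂ) * Complex.I)) ^ 2 *
      (∮ z₂ in C(0, ε₂), ∮ z₁ in C(0, ε₁),
        (z₂ - z₁) * ek k z₁ z₂ * z₁ ^ a * wa b z₁ z₂ / (z₁ ^ N * z₂ ^ N)) =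
    -(1 / 2 : ℂ) * (1 / (2 * (Real.pi : ℂ) * Complex.I)) ^ 2 *
      (∮ z₂ in C(0, ε₂), ∮ z₁ in C(0, ε₁),
        ek k z₁ z₂ * (z₁ - z₂) ^ 2 * wa a z₁ z₂ * wa b z₁ z₂ / (z₁ ^ N * z₂ ^ N)) := by
  obtain ⟨p, hp⟩ := exists_poly k a b
  have e1 : ∀ z w : ℂ, (w - z) * ek k z w * z ^ a * wa b z w =
      1 * MvPolynomial.eval ![z, w] p + 0 * MvPolynomial.eval ![w, z] p := by
    intro z w
    rw [hp]
    ring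
  have e2 : ∀ z w : ℂ, ek k z w * (z - w) ^ 2 * wa a z w * wa b z w =
      (-1) * MvPolynomial.eval ![z, w] p + (-1) * MvPolynomial.eval ![w, z] p := by
    intro z w
    rw [hp, hp, ek_symm k z w, wa_symm b z w]
    linear_combination (ek k z w * wa b z w * (z - w)) * wa_mul a z w
  simp only [e1, e2]
  rw [aux_I N p _ _ _ _ hε₁ hε₂, aux_I N p _ _ _ _ hε₁ hε₂]
  ring
end

section
/- Let N ≥ 2 be an integer and let J ⊆ ℂ[z₁,z₂] be the ideal generated by z₁^N and Σ_{j=0}^{N−1} z₁^j·z₂^{N−1−j}. Then every homogeneous polynomial f ∈ ℂ[z₁,z₂] of degree 2N − 3 is congruent modulo J to c·z₁^{N−1}·z₂^{N−2} for a unique complex number c; equivalently, the image of the degree-(2N−3) homogeneous component of ℂ[z₁,z₂] in the quotient ring ℂ[z₁,z₂]/J is a one-dimensional ℂ-vector space spanned by the class of z₁^{N−1}·z₂^{N−2}. -/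
open MvPolynomial

noncomputable def ee (a b : ℕ) : Fin 2 →₀ ℕ := Finsupp.single 0 a + Finsupp.single 1 b

lemma ee_mon (a b : ℕ) :
    (X 0 ^ a * X 1 ^ b : MvPolynomial (Fin 2) ℂ) = monomial (ee a b) 1 := by
  rw [X_pow_eq_monomial, X_pow_eq_monomial, monomial_mul, ee, mul_one]

lemma ee_le (a b c d : ℕ) : ee a b ≤ ee c d ↔ a ≤ c ∧ b ≤ d := by
  simp [ee, Finsupp.le_def, Fin.forall_fin_two]

lemma ee_sub (a b c d : ℕ) : ee a b - ee c d = ee (a - c) (b - d) := by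
  ext i
  fin_cases i <;> simp [ee]

lemma ee_coeff (p : MvPolynomial (Fin 2) ℂ) (a b j k : ℕ) :
    coeff (ee a b) (p * (X 0 ^ j * X 1 ^ k)) =
      if j ≤ a ∧ k ≤ b then coeff (ee (a - j) (b - k)) p else 0 := by
  rw [ee_mon, coeff_mul_monomial', ee_sub]
  simp only [ee_le, mul_one]

lemma phi_J (n : ℕ) (p : MvPolynomial (Fin 2) ℂ)
    (hp : p ∈ Ideal.span {(X 0 ^ (n+2) : MvPolynomial (Fin 2) ℂ),
      ∑ j ∈ Finset.range (n+2), X 0 ^ j * X 1 ^ (n + 1 - j)}) :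
    coeff (ee (n+1) n) p = coeff (ee n (n+1)) p := by
  obtain ⟨a, b, rfl⟩ := Ideal.mem_span_pair.1 hp
  have h0 : (X 0 ^ (n+2) : MvPolynomial (Fin 2) ℂ) = X 0 ^ (n+2) * X 1 ^ 0 := by simp
  rw [h0, coeff_add, coeff_add, ee_coeff, ee_coeff, Finset.mul_sum, coeff_sum, coeff_sum]
  simp only [ee_coeff]
  rw [if_neg (by omega), if_neg (by omega), zero_add, zero_add,
    Finset.sum_range_succ' (n := n + 1) (f := fun x => if x ≤ n + 1 ∧ n + 1 - x ≤ n then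
      coeff (ee (n + 1 - x) (n - (n + 1 - x))) b else 0),
    Finset.sum_range_succ (n := n + 1) (f := fun x => if x ≤ n ∧ n + 1 - x ≤ n + 1 then
      coeff (ee (n - x) (n + 1 - (n + 1 - x))) b else 0), if_neg (by omega), if_neg (by omega)]
  congr 1
  apply Finset.sum_congr rfl
  intro i hi
  have := Finset.mem_range.1 hi
  rw [if_pos (by omega), if_pos (by omega)]
  congr 2 <;> omega

lemma aux_main (n : ℕ) (J : Ideal (MvPolynomial (Fin 2) ℂ))
    (hJ : J = Ideal.span {X 0 ^ (n+2), ∑ j ∈ Finset.range (n+2), X 0 ^ j * X 1 ^ (n + 1 - j)})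
    (f : MvPolynomial (Fin 2) ℂ) (hf : f.IsHomogeneous (2 * n + 1)) :
    ∃! c : ℂ, f - C c * (X 0 ^ (n + 1) * X 1 ^ n) ∈ J := by
  have hx : (X 0 ^ (n+2) : MvPolynomial (Fin 2) ℂ) ∈ J := by
    rw [hJ]; exact Ideal.subset_span (by simp)
  have hS : (∑ j ∈ Finset.range (n+2), X 0 ^ j * X 1 ^ (n + 1 - j) :
      MvPolynomial (Fin 2) ℂ) ∈ J := by
    rw [hJ]; exact Ideal.subset_span (by simp)
  have hy : (X 1 ^ (n+2) : MvPolynomial (Fin 2) ℂ) ∈ J := by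
    have h := (Commute.all (X 0 : MvPolynomial (Fin 2) ℂ) (X 1)).geom_sum₂_mul (n+2)
    have h2 : (X 1 ^ (n+2) : MvPolynomial (Fin 2) ℂ) = X 0 ^ (n+2) -
      (∑ j ∈ Finset.range (n+2), X 0 ^ j * X 1 ^ (n + 1 - j)) * (X 0 - X 1) := by
      have h3 : n + 2 - 1 = n + 1 := rfl
      rw [h3] at h
      rw [h]; ring
    rw [h2]
    exact J.sub_mem hx (J.mul_mem_right _ hS)
  have hmid : (X 0 ^ n * X 1 ^ (n+1) + X 0 ^ (n+1) * X 1 ^ n : MvPolynomial (Fin 2) ℂ) ∈ J := by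
    have h := J.mul_mem_left (X 0 ^ n) hS
    rw [Finset.sum_range_succ', Finset.sum_range_succ', mul_add, mul_add, Finset.mul_sum,
      add_assoc] at h
    rw [Ideal.add_mem_iff_right] at h
    · convert h using 1
      simp only [zero_add, pow_zero, Nat.sub_zero, Nat.add_sub_cancel]
      ring
    · apply J.sum_mem
      intro i _
      have : (X 0 ^ n * (X 0 ^ (i+1+1) * X 1 ^ (n + 1 - (i+1+1))) : MvPolynomial (Fin 2) ℂ)
        = X 0 ^ i * X 1 ^ (n + 1 - (i+1+1)) * X 0 ^ (n+2) := by ring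
      rw [this]
      exact J.mul_mem_left _ hx
  have key : f ∈ J.restrictScalars ℂ ⊔
      Submodule.span ℂ {(X 0 ^ (n + 1) * X 1 ^ n : MvPolynomial (Fin 2) ℂ)} := by
    rw [f.as_sum]
    apply Submodule.sum_mem
    intro m hm
    have hd := hf (mem_support_iff.1 hm)
    have hme : m = ee (m 0) (m 1) := by
      ext i
      fin_cases i <;> simp [ee]
    have hdeg : m 0 + m 1 = 2 * n + 1 := by
      rw [hme] at hd
      simpa [ee, Finsupp.weight_apply, Finsupp.sum_fintype] using hd
    have hmm : monomial m (coeff m f) = (coeff m f) • (X 0 ^ (m 0) * X 1 ^ (m 1) :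
        MvPolynomial (Fin 2) ℂ) := by
      rw [ee_mon, ← hme, smul_monomial, smul_eq_mul, mul_one]
    rw [hmm]
    apply Submodule.smul_mem
    generalize m 0 = a at *
    generalize m 1 = b at *
    by_cases ha : n + 2 ≤ a
    · apply Submodule.mem_sup_left
      exact J.mul_mem_right _ (J.mem_of_dvd (pow_dvd_pow _ ha) hx)
    by_cases hb : n + 2 ≤ b
    · apply Submodule.mem_sup_left
      exact J.mul_mem_left _ (J.mem_of_dvd (pow_dvd_pow _ hb) hy)
    obtain ⟨rfl, rfl⟩ | ⟨rfl, rfl⟩ : (a = n + 1 ∧ b = n) ∨ (a = n ∧ b = n + 1) := by omega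
    · exact Submodule.mem_sup_right (Submodule.mem_span_singleton_self _)
    · rw [← add_sub_cancel_right (X 0 ^ a * X 1 ^ (a+1) : MvPolynomial (Fin 2) ℂ)
        (X 0 ^ (a+1) * X 1 ^ a)]
      exact Submodule.sub_mem _ (Submodule.mem_sup_left hmid)
        (Submodule.mem_sup_right (Submodule.mem_span_singleton_self _))
  obtain ⟨y, hyJ, z, hz, hyz⟩ := Submodule.mem_sup.1 key
  obtain ⟨c, rfl⟩ := Submodule.mem_span_singleton.1 hz
  have hco (c : ℂ) (h : f - C c * (X 0 ^ (n + 1) * X 1 ^ n) ∈ J) :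
      c = coeff (ee (n+1) n) f - coeff (ee n (n+1)) f := by
    rw [hJ] at h
    have := phi_J n _ h
    rw [coeff_sub, coeff_sub, ee_coeff, ee_coeff, if_pos (by omega), if_neg (by omega)] at this
    have h0 : ee (n + 1 - (n + 1)) (n - n) = 0 := by simp [ee]
    rw [h0, coeff_zero_C] at this
    linear_combination -this
  have hc : f - C c * (X 0 ^ (n + 1) * X 1 ^ n) ∈ J := by
    rw [← hyz, smul_eq_C_mul, add_sub_cancel_right]
    exact hyJ
  exact ⟨c, hc, fun d hd => (hco d hd).trans (hco c hc).symm⟩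

theorem stmt_12 (N : ℕ) (hN : 2 ≤ N)
    (J : Ideal (MvPolynomial (Fin 2) ℂ))
    (hJ : J = Ideal.span {X 0 ^ N, ∑ j ∈ Finset.range N, X 0 ^ j * X 1 ^ (N - 1 - j)})
    (f : MvPolynomial (Fin 2) ℂ) (hf : f.IsHomogeneous (2 * N - 3)) :
    ∃! c : ℂ, f - C c * (X 0 ^ (N - 1) * X 1 ^ (N - 2)) ∈ J := by
  obtain ⟨n, rfl⟩ := Nat.exists_eq_add_of_le' hN
  have h : 2 * (n + 2) - 3 = 2 * n + 1 := by omega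
  rw [h] at hf
  exact aux_main n J hJ f hf
end

section
/- Let N ≥ 1 be an integer, let f(z₁,z₂) ∈ ℂ[z₁,z₂], and suppose f lies in the ideal J of ℂ[z₁,z₂] generated by z₁^N and Σ_{j=0}^{N−1} z₁^j·z₂^{N−1−j}. Then the coefficient of the monomial z₁^{N−1}·z₂^{N−1} in the polynomial (z₂ − z₁)·f(z₁,z₂) is zero. -/
open MvPolynomial

theorem aux_coeff (N : ℕ) (hN : 1 ≤ N) (i : Fin 2) (p : MvPolynomial (Fin 2) ℂ) :
    (X i ^ N * p).coeff (Finsupp.single 0 (N - 1) + Finsupp.single 1 (N - 1)) = 0 := by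
  rw [X_pow_eq_monomial, coeff_monomial_mul', if_neg]
  intro h
  have h1 := h i
  fin_cases i <;> simp at h1 <;> omega

theorem stmt_13 (N : ℕ) (hN : 1 ≤ N) (f : MvPolynomial (Fin 2) ℂ)
    (hf : f ∈ Ideal.span
      ({X 0 ^ N, ∑ j ∈ Finset.range N, X 0 ^ j * X 1 ^ (N - 1 - j)} :
        Set (MvPolynomial (Fin 2) ℂ))) :
    ((X 1 - X 0) * f).coeff (Finsupp.single 0 (N - 1) + Finsupp.single 1 (N - 1)) = 0 := by
  obtain ⟨a, b, rfl⟩ := Ideal.mem_span_pair.1 hf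
  have hg := geom_sum₂_mul (X 0 : MvPolynomial (Fin 2) ℂ) (X 1) N
  have key : (X 1 - X 0) * (a * X 0 ^ N +
      b * ∑ j ∈ Finset.range N, X 0 ^ j * X 1 ^ (N - 1 - j)) =
      X 0 ^ N * ((X 1 - X 0) * a - b) + (X 1 ^ N * b : MvPolynomial (Fin 2) ℂ) := by
    linear_combination (-b) * hg
  rw [key, coeff_add, aux_coeff N hN, aux_coeff N hN, add_zero]
end
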